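/- arXiv:1306.1195 — 2 statements merged into one kernel-verified Lean document; each statement's English description precedes it below -/
import Mathlib

section
/- Let D be a positive integer and τ ∈ (0, 1/4). Define Φ_τ : ℝ^D → ℝ^D by Φ_τ(x) = 0 if |x| ≤ τ, Φ_τ(x) = √τ · ((|x| − τ)/(√τ − τ)) · x/|x| if τ ≤ |x| ≤ √τ, and Φ_τ(x) = x if |x| ≥ √τ. Then Φ_τ is Lipschitz with constant 1 + 2√τ, i.e. |Φ_τ(x) − Φ_τ(y)| ≤ (1 + 2√τ)|x − y| for all x, y ∈ ℝ^D. -/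
/-- Rescaling two vectors by factors in `[0, 1]` is `K`-Lipschitz, `K ≥ 1`, as soon as the norms
of the rescaled vectors are. -/
lemma norm_smul_sub_smul_le_of_abs_sub_le {E : Type*} [NormedAddCommGroup E]
    [InnerProductSpace ℝ E] {x y : E} {c d K : ℝ} (hc : c ∈ Set.Icc (0 : ℝ) 1)
    (hd : d ∈ Set.Icc (0 : ℝ) 1) (hK : 1 ≤ K)
    (h : |c * ‖x‖ - d * ‖y‖| ≤ K * |‖x‖ - ‖y‖|) :
    ‖c • x - d • y‖ ≤ K * ‖x - y‖ := by
  have hsq : (c * ‖x‖ - d * ‖y‖) ^ 2 ≤ K ^ 2 * (‖x‖ - ‖y‖) ^ 2 := by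
    rw [← sq_abs (c * ‖x‖ - d * ‖y‖), ← sq_abs (‖x‖ - ‖y‖), ← mul_pow]
    exact pow_le_pow_left₀ (abs_nonneg _) h 2
  have hcd : c * d ≤ K ^ 2 :=
    (mul_le_one₀ hc.2 hd.1 hd.2).trans (one_le_pow₀ hK)
  have hinner : 0 ≤ ‖x‖ * ‖y‖ - inner ℝ x y := sub_nonneg.2 (real_inner_le_norm x y)
  refine le_of_sq_le_sq ?_ (by positivity)
  rw [mul_pow, norm_sub_sq_real, norm_sub_sq_real, norm_smul, norm_smul, real_inner_smul_left,
    real_inner_smul_right, Real.norm_of_nonneg hc.1, Real.norm_of_nonneg hd.1]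
  nlinarith [mul_le_mul_of_nonneg_right hcd hinner]

/-- The radial profile `r ↦ max 0 (min r (L (r - τ)))` is `K`-Lipschitz for `K ≥ max 1 L`. -/
lemma abs_max_zero_min_sub_le {τ L K : ℝ} (hL : 0 ≤ L) (hLK : L ≤ K) (hK : 1 ≤ K) (a b : ℝ) :
    |max 0 (min a (L * (a - τ))) - max 0 (min b (L * (b - τ)))| ≤ K * |a - b| := by
  have hlin : |L * (a - τ) - L * (b - τ)| ≤ K * |a - b| := by
    rw [← mul_sub, sub_sub_sub_cancel_right, abs_mul, abs_of_nonneg hL]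
    gcongr
  have hmin := (abs_min_sub_min_le_max a (L * (a - τ)) b (L * (b - τ))).trans
    (max_le (le_mul_of_one_le_left (abs_nonneg _) hK) hlin)
  refine (abs_max_sub_max_le_max _ _ _ _).trans (max_le ?_ hmin)
  rw [sub_self, abs_zero]
  positivity

/-- For `τ ∈ (0, 1/4)`, the radial truncation map `Φ_τ : ℝ^D → ℝ^D` (equal to `0`
on `{|x| ≤ τ}`, to `√τ · ((|x| − τ)/(√τ − τ)) · x/|x|` on the annulus
`{τ ≤ |x| ≤ √τ}`, and to the identity on `{|x| ≥ √τ}`) is Lipschitz with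
constant `1 + 2√τ`. -/
theorem radial_truncation_lipschitz_estimate
    (D : ℕ) (hD : 0 < D) (τ : ℝ) (hτ : τ ∈ Set.Ioo (0 : ℝ) (1/4))
    (Φ : EuclideanSpace ℝ (Fin D) → EuclideanSpace ℝ (Fin D))
    (hΦ₀ : ∀ x, ‖x‖ ≤ τ → Φ x = 0)
    (hΦ₁ : ∀ x, τ ≤ ‖x‖ → ‖x‖ ≤ Real.sqrt τ →
      Φ x = (Real.sqrt τ * ((‖x‖ - τ) / (Real.sqrt τ - τ)) * ‖x‖⁻¹) • x)
    (hΦ₂ : ∀ x, Real.sqrt τ ≤ ‖x‖ → Φ x = x) :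
    ∀ x y, ‖Φ x - Φ y‖ ≤ (1 + 2 * Real.sqrt τ) * ‖x - y‖ := by
  obtain ⟨hτ0, hτ4⟩ := hτ
  obtain ⟨s, hs⟩ : ∃ s, s = Real.sqrt τ := ⟨_, rfl⟩
  rw [← hs] at hΦ₁ hΦ₂ ⊢
  have hs0 : 0 < s := hs ▸ Real.sqrt_pos.2 hτ0
  have hsτ : τ = s ^ 2 := by rw [hs, Real.sq_sqrt hτ0.le]
  have hs2 : s < 1 / 2 := by nlinarith
  have h1s : 0 < 1 - s := by linarith
  have hrep : ∀ x, ∃ c ∈ Set.Icc (0 : ℝ) 1, Φ x = c • x ∧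
      c * ‖x‖ = max 0 (min ‖x‖ ((1 - s)⁻¹ * (‖x‖ - τ))) := by
    intro x
    rcases le_total ‖x‖ τ with h | h
    · refine ⟨0, by simp, by rw [hΦ₀ x h, zero_smul], ?_⟩
      rw [zero_mul, max_eq_left]
      exact (min_le_right _ _).trans
        (mul_nonpos_of_nonneg_of_nonpos (inv_nonneg.2 h1s.le) (by linarith))
    have hx : 0 < ‖x‖ := hτ0.trans_le h
    have hnonneg : 0 ≤ (1 - s)⁻¹ * (‖x‖ - τ) :=
      mul_nonneg (inv_nonneg.2 h1s.le) (by linarith)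
    rcases le_total ‖x‖ s with h' | h'
    · have hle : (1 - s)⁻¹ * (‖x‖ - τ) ≤ ‖x‖ := by
        rw [inv_mul_le_iff₀ h1s]
        nlinarith
      have hcoef : s * ((‖x‖ - τ) / (s - τ)) = (1 - s)⁻¹ * (‖x‖ - τ) := by
        rw [hsτ, show s - s ^ 2 = s * (1 - s) by ring]
        field_simp
      refine ⟨_, ⟨?_, ?_⟩, hΦ₁ x h h', ?_⟩
      · rw [hcoef]
        positivity
      · rw [hcoef, ← div_eq_mul_inv]
        exact (div_le_one hx).2 hle
      · rw [hcoef, inv_mul_cancel_right₀ hx.ne', min_eq_right hle, max_eq_right hnonneg]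
    · refine ⟨1, by simp, by rw [hΦ₂ x h', one_smul], ?_⟩
      have hle : ‖x‖ ≤ (1 - s)⁻¹ * (‖x‖ - τ) := by
        rw [le_inv_mul_iff₀ h1s]
        nlinarith
      rw [one_mul, min_eq_left hle, max_eq_right hx.le]
  have hslope : (1 - s)⁻¹ ≤ 1 + 2 * s := by
    rw [inv_le_iff_one_le_mul₀ h1s]
    nlinarith
  intro x y
  obtain ⟨c, hc, hcx, hcn⟩ := hrep x
  obtain ⟨d, hd, hdy, hdn⟩ := hrep y
  have hK : 1 ≤ 1 + 2 * s := by linarith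
  rw [hcx, hdy]
  refine norm_smul_sub_smul_le_of_abs_sub_le hc hd hK ?_
  rw [hcn, hdn]
  exact abs_max_zero_min_sub_le (inv_nonneg.2 h1s.le) hslope hK _ _
end

section
/- Let D be a positive integer and τ ∈ (0, 1/4). Define g on the closed annulus A = {x ∈ ℝ^D : τ ≤ |x| ≤ √τ} by g(x) = √τ · ((|x| − τ)/(√τ − τ)) · x/|x|. Then g is Lipschitz on A with constant (1 − √τ)^{-1}, i.e. |g(x) − g(y)| ≤ (1 − √τ)^{-1} |x − y| for all x, y ∈ A. -/
/-- Moving every point of norm at least `t` radially towards the origin by the distance `t`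
does not increase distances. -/
theorem norm_radial_shrink_sub_le {E : Type*} [NormedAddCommGroup E] [InnerProductSpace ℝ E]
    {t : ℝ} (ht : 0 < t) {x y : E} (hx : t ≤ ‖x‖) (hy : t ≤ ‖y‖) :
    ‖((‖x‖ - t) * ‖x‖⁻¹) • x - ((‖y‖ - t) * ‖y‖⁻¹) • y‖ ≤ ‖x - y‖ := by
  have hx0 : 0 < ‖x‖ := ht.trans_le hx
  have hy0 : 0 < ‖y‖ := ht.trans_le hy
  have hxx : inner ℝ x y = ‖x‖ * ‖y‖ * (inner ℝ x y / (‖x‖ * ‖y‖)) := by field_simp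
  have hu : inner ℝ x y / (‖x‖ * ‖y‖) ≤ 1 :=
    div_le_one_of_le₀ (real_inner_le_norm x y) (by positivity)
  set u := inner ℝ x y / (‖x‖ * ‖y‖)
  refine (sq_le_sq₀ (norm_nonneg _) (norm_nonneg _)).mp ?_
  rw [norm_sub_sq_real, norm_sub_sq_real, norm_smul, norm_smul, real_inner_smul_left,
    real_inner_smul_right, hxx, mul_pow, mul_pow, Real.norm_eq_abs, Real.norm_eq_abs, sq_abs,
    sq_abs]
  have key : 0 ≤ (t * ‖x‖ + t * (‖y‖ - t)) * (1 - u) :=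
    mul_nonneg (add_nonneg (by positivity) (mul_nonneg ht.le (by linarith))) (by linarith)
  have h : ((‖x‖ - t) * ‖x‖⁻¹) ^ 2 * ‖x‖ ^ 2
      - 2 * ((‖x‖ - t) * ‖x‖⁻¹ * ((‖y‖ - t) * ‖y‖⁻¹ * (‖x‖ * ‖y‖ * u)))
      + ((‖y‖ - t) * ‖y‖⁻¹) ^ 2 * ‖y‖ ^ 2
      = (‖x‖ - t) ^ 2 - 2 * ((‖x‖ - t) * (‖y‖ - t) * u) + (‖y‖ - t) ^ 2 := by
    field_simp
  rw [h]
  linarith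

/-- For `τ ∈ (0, 1/4)`, the map `g(x) = √τ · ((|x| − τ)/(√τ − τ)) · x/|x|` is
Lipschitz with constant `(1 − √τ)⁻¹` on the closed annulus
`{x ∈ ℝ^D : τ ≤ |x| ≤ √τ}`. -/
theorem annulus_interpolation_lipschitz
    (D : ℕ) (hD : 0 < D) (τ : ℝ) (hτ : τ ∈ Set.Ioo (0 : ℝ) (1/4))
    (x y : EuclideanSpace ℝ (Fin D))
    (hx₁ : τ ≤ ‖x‖) (hx₂ : ‖x‖ ≤ Real.sqrt τ)
    (hy₁ : τ ≤ ‖y‖) (hy₂ : ‖y‖ ≤ Real.sqrt τ) :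
    ‖(Real.sqrt τ * ((‖x‖ - τ) / (Real.sqrt τ - τ)) * ‖x‖⁻¹) • x -
        (Real.sqrt τ * ((‖y‖ - τ) / (Real.sqrt τ - τ)) * ‖y‖⁻¹) • y‖ ≤
      (1 - Real.sqrt τ)⁻¹ * ‖x - y‖ := by
  obtain ⟨h0, h1⟩ := hτ
  have hs0 : 0 < Real.sqrt τ := Real.sqrt_pos.mpr h0
  have hs1 : Real.sqrt τ < 1 := by
    rw [Real.sqrt_lt' one_pos]
    linarith
  have hs : Real.sqrt τ - τ = Real.sqrt τ * (1 - Real.sqrt τ) := by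
    rw [mul_sub, Real.mul_self_sqrt h0.le, mul_one]
  have hscale (r : ℝ) : Real.sqrt τ * ((r - τ) / (Real.sqrt τ - τ)) * r⁻¹
      = (1 - Real.sqrt τ)⁻¹ * ((r - τ) * r⁻¹) := by
    rw [hs, mul_div_assoc', mul_div_mul_left _ _ hs0.ne', div_eq_inv_mul, mul_assoc]
  have hpos : 0 ≤ (1 - Real.sqrt τ)⁻¹ := inv_nonneg.mpr (by linarith)
  rw [hscale, hscale, mul_smul (1 - Real.sqrt τ)⁻¹, mul_smul (1 - Real.sqrt τ)⁻¹, ← smul_sub,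
    norm_smul, Real.norm_of_nonneg hpos]
  exact mul_le_mul_of_nonneg_left (norm_radial_shrink_sub_le h0 hx₁ hy₁) hpos
end
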